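/- Let X be a real Banach space, f ∈ X, and let N : X → X be analytic at f with infinite radius of convergence. Assume ‖N^{(n)}(f)‖ ≤ M a^n n! for all n ∈ ℕ, where M, a > 0. Then the terms of the Adomian sequence satisfy ‖u_n‖ ≤ ((2n−1)!/(n!)²)·M^n·a^{n−1} for every n ∈ ℕ*. -/

import Mathlib

open scoped BigOperators

variable {X : Type*} [NormedAddCommGroup X] [NormedSpace ℝ X] [CompleteSpace X]

/-- The set of tuples `(j 0, …, j (n-1))` of nonnegative integers (representing
`(j_1, …, j_n)`) with `j_1 + 2 j_2 + ⋯ + n j_n = n`. -/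
def adomianTuples (n : ℕ) : Finset (Fin n → ℕ) :=
  (Fintype.piFinset fun _ : Fin n => Finset.range (n + 1)).filter
    fun j => ∑ i : Fin n, (i.1 + 1) * j i = n

/-- The list consisting of `j i` copies of `g i`, for `i = 0, …, n-1` in order. -/
def repList {X : Type*} {n : ℕ} (j : Fin n → ℕ) (g : Fin n → X) : List X :=
  (List.ofFn fun i => List.replicate (j i) (g i)).flatten

theorem repList_length {X : Type*} {n : ℕ} (j : Fin n → ℕ) (g : Fin n → X) :
    (repList j g).length = ∑ i : Fin n, j i := by
  simp [repList, List.length_flatten, List.map_ofFn, Function.comp_def, List.sum_ofFn]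

/-- The family of arguments `g 0, …, g 0, g 1, …, g 1, …` with `g i` repeated `j i` times,
indexed by `Fin (∑ i, j i)`: this realizes the application
`F.(x_1^{[j_1]} ⋯ x_n^{[j_n]})` of a (symmetric) multilinear map `F`. -/
def repArgs {X : Type*} {n : ℕ} (j : Fin n → ℕ) (g : Fin n → X) :
    Fin (∑ i : Fin n, j i) → X :=
  fun k => (repList j g).get (Fin.cast (repList_length j g).symm k)

/-- The `n`-th Adomian polynomial
`A_n = ∑_{j_1+2j_2+⋯+nj_n=n} (1/(j_1!⋯j_n!)) N^{(j_1+⋯+j_n)}(f).(u_1^{[j_1]} ⋯ u_n^{[j_n]})`,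
where `N^{(p)}(f)` is the `p`-th (iterated Fréchet) derivative of `N` at `f`. -/
noncomputable def adomianA (N : X → X) (f : X) (u : ℕ → X) (n : ℕ) : X :=
  ∑ j ∈ adomianTuples n,
    (∏ i : Fin n, ((j i).factorial : ℝ))⁻¹ •
      iteratedFDeriv ℝ (∑ i : Fin n, j i) N f (repArgs j fun i => u (i.1 + 1))

/-- `N` is analytic at `f` with infinite radius of convergence:
`N x = N f + ∑_{p≥1} (1/p!) N^{(p)}(f).(x-f)^{[p]}` for every `x ∈ X`, the series converging
absolutely, where the coefficients `N^{(p)}(f)` are the iterated Fréchet derivatives of `N`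
at `f` (the `p = 0` term of the `HasSum` below being exactly `N f`). -/
def HasEntireExpansionAt (N : X → X) (f : X) : Prop :=
  ∀ x : X,
    HasSum (fun p : ℕ => ((p.factorial : ℝ))⁻¹ •
      iteratedFDeriv ℝ p N f fun _ => x - f) (N x) ∧
    Summable fun p : ℕ => ((p.factorial : ℝ))⁻¹ * ‖iteratedFDeriv ℝ p N f fun _ => x - f‖

theorem mem_adomianTuples {n : ℕ} {j : Fin n → ℕ} :
    j ∈ adomianTuples n ↔ ∑ i : Fin n, (i.1 + 1) * j i = n := by
  simp only [adomianTuples, Finset.mem_filter, Fintype.mem_piFinset, Finset.mem_range,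
    and_iff_right_iff_imp]
  intro h i
  have := Finset.single_le_sum (f := fun i : Fin n => (i.1 + 1) * j i)
    (fun _ _ => Nat.zero_le _) (Finset.mem_univ i)
  simp only [h] at this
  nlinarith [Nat.zero_le (i.1 * j i)]

theorem sum_le_of_mem_adomianTuples {n : ℕ} {j : Fin n → ℕ} (h : j ∈ adomianTuples n) :
    ∑ i, j i ≤ n := by
  calc ∑ i, j i ≤ ∑ i : Fin n, (i.1 + 1) * j i :=
        Finset.sum_le_sum fun i _ => Nat.le_mul_of_pos_left _ i.1.succ_pos
    _ = n := mem_adomianTuples.1 h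

open PowerSeries in
theorem coe_trunc_mk_mul_X {R : Type*} [CommSemiring R] (x : ℕ → R) (n : ℕ) :
    ((trunc (n + 1) (mk x * PowerSeries.X) : Polynomial R) : PowerSeries R) =
      ∑ i : Fin n, C (x i) * PowerSeries.X ^ (i.1 + 1) := by
  ext m
  rw [Polynomial.coeff_coe, coeff_trunc, map_sum,
    Fin.sum_univ_eq_sum_range (fun i => coeff m (C (x i) * PowerSeries.X ^ (i + 1)))]
  cases m with
  | zero => simp [coeff_X_pow]
  | succ m => simp [coeff_succ_mul_X, coeff_X_pow]

open PowerSeries in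
theorem coeff_mk_mul_X_pow {R : Type*} [CommSemiring R] (x : ℕ → R) (n p : ℕ) :
    coeff n ((mk x * PowerSeries.X) ^ p) = ∑ j ∈ adomianTuples n with ∑ i, j i = p,
      (Nat.multinomial Finset.univ j : R) * ∏ i : Fin n, x i ^ j i := by
  have h := congrArg (Polynomial.coeff · n) (trunc_trunc_pow (mk x * PowerSeries.X) (n + 1) p)
  simp only [coeff_trunc, Nat.lt_succ_self, if_true, coe_trunc_mk_mul_X] at h
  have hfilter : ((adomianTuples n).filter fun j => ∑ i, j i = p) =
      (Finset.piAntidiag Finset.univ p).filter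
        fun j : Fin n → ℕ => n = ∑ i : Fin n, (i.1 + 1) * j i := by
    ext j
    simp [mem_adomianTuples, and_comm, eq_comm]
  rw [← h, Finset.sum_pow_eq_sum_piAntidiag, map_sum, hfilter, Finset.sum_filter]
  refine Finset.sum_congr rfl fun j _ => ?_
  have hprod : ∏ i : Fin n, (C (x i) * PowerSeries.X ^ (i.1 + 1) : PowerSeries R) ^ j i =
      C (∏ i : Fin n, x i ^ j i) * PowerSeries.X ^ ∑ i : Fin n, (i.1 + 1) * j i := by
    simp [mul_pow, Finset.prod_mul_distrib, ← pow_mul, Finset.prod_pow_eq_pow_sum]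
  rw [hprod, ← map_natCast (C (R := R)), coeff_C_mul, coeff_C_mul, coeff_X_pow]
  simp

open PowerSeries in
theorem catalanSeries_eq_geom_sum_add (m : ℕ) :
    catalanSeries = ∑ p ∈ Finset.range m, (catalanSeries * PowerSeries.X) ^ p +
      catalanSeries * (catalanSeries * PowerSeries.X) ^ m := by
  induction m with
  | zero => simp
  | succ m ih =>
    conv_lhs => rw [ih]
    rw [Finset.sum_range_succ, add_assoc]
    congr 1
    conv_lhs => enter [1]; rw [← catalanSeries_sq_mul_X_add_one]
    ring

open PowerSeries in
theorem sum_adomianTuples_multinomial_mul_catalan (n : ℕ) :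
    ∑ j ∈ adomianTuples n, Nat.multinomial Finset.univ j * ∏ i : Fin n, catalan i ^ j i =
      catalan n := by
  have h := congrArg (coeff n) (catalanSeries_eq_geom_sum_add (n + 1))
  rw [mul_pow _ _ (n + 1), ← mul_assoc, map_add, coeff_mul_X_pow', if_neg (by omega), add_zero,
    catalanSeries_coeff, map_sum] at h
  rw [h]
  have hmaps : ∀ j ∈ adomianTuples n, ∑ i, j i ∈ Finset.range (n + 1) := fun j hj =>
    Finset.mem_range_succ_iff.2 (sum_le_of_mem_adomianTuples hj)
  rw [← Finset.sum_fiberwise_of_maps_to hmaps]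
  refine Finset.sum_congr rfl fun p _ => ?_
  simpa [catalanSeries] using (coeff_mk_mul_X_pow catalan n p).symm

theorem prod_repArgs {Y R : Type*} [CommMonoid R] {n : ℕ} (j : Fin n → ℕ) (g : Fin n → Y)
    (φ : Y → R) : ∏ k, φ (repArgs j g k) = ∏ i, φ (g i) ^ j i := by
  have h : ∏ k, φ (repArgs j g k) = ((repList j g).map φ).prod := by
    rw [← Fin.prod_univ_fun_getElem]
    exact Fintype.prod_equiv (finCongr (repList_length j g).symm) _ _ fun _ => rfl
  rw [h]
  simp [repList, List.map_flatten, List.prod_flatten, List.map_ofFn, Function.comp_def,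
    List.prod_ofFn]

theorem catalan_le_factorial_div (n : ℕ) :
    (catalan n : ℝ) ≤ ((2 * (n + 1) - 1).factorial : ℝ) / ((n + 1).factorial : ℝ) ^ 2 := by
  have h1 : ((n : ℝ) + 1) * catalan n = n.centralBinom := by
    exact_mod_cast succ_mul_catalan_eq_centralBinom n
  have h2 : (n.centralBinom : ℝ) * n.factorial * n.factorial = (2 * n).factorial := by
    have := Nat.choose_mul_factorial_mul_factorial (show n ≤ 2 * n by omega)
    rw [show 2 * n - n = n by omega] at this
    exact_mod_cast this
  rw [show 2 * (n + 1) - 1 = 2 * n + 1 by omega, le_div_iff₀ (by positivity),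
    Nat.factorial_succ, Nat.factorial_succ]
  push_cast
  rw [← h2, ← h1]
  have : 0 ≤ (n : ℝ) * ((n + 1) * catalan n * n.factorial * n.factorial) := by positivity
  linarith

theorem norm_adomianA_le {X : Type*} [NormedAddCommGroup X] [NormedSpace ℝ X]
    {N : X → X} {f : X} {M a : ℝ} (hM : 0 ≤ M) (ha : 0 ≤ a)
    (hderiv : ∀ n : ℕ, ‖iteratedFDeriv ℝ n N f‖ ≤ M * a ^ n * n.factorial)
    {u : ℕ → X} {n : ℕ}
    (hu : ∀ i < n, ‖u (i + 1)‖ ≤ catalan i * M ^ (i + 1) * a ^ i) :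
    ‖adomianA N f u n‖ ≤ catalan n * M ^ (n + 1) * a ^ n := by
  rw [adomianA, ← sum_adomianTuples_multinomial_mul_catalan, Nat.cast_sum, Finset.sum_mul,
    Finset.sum_mul]
  refine norm_sum_le_of_le _ fun j hj => ?_
  have hj' := mem_adomianTuples.1 hj
  have hpos : (0 : ℝ) < ∏ i : Fin n, ((j i).factorial : ℝ) :=
    Finset.prod_pos fun i _ => by positivity
  have hmul : (∏ i : Fin n, ((j i).factorial : ℝ)) * Nat.multinomial Finset.univ j =
      (∑ i, j i).factorial := by
    exact_mod_cast Nat.multinomial_spec Finset.univ j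
  have hsum : ∑ i, j i + ∑ i : Fin n, i.1 * j i = n := by
    rw [← Finset.sum_add_distrib]
    exact (Finset.sum_congr rfl fun i _ => by ring).trans hj'
  rw [norm_smul, norm_inv, Real.norm_of_nonneg hpos.le, inv_mul_le_iff₀ hpos]
  calc ‖iteratedFDeriv ℝ (∑ i, j i) N f (repArgs j fun i => u (i.1 + 1))‖
      ≤ ‖iteratedFDeriv ℝ (∑ i, j i) N f‖ * ∏ k, ‖repArgs j (fun i => u (i.1 + 1)) k‖ :=
        ContinuousMultilinearMap.le_opNorm _ _
    _ = ‖iteratedFDeriv ℝ (∑ i, j i) N f‖ * ∏ i : Fin n, ‖u (i.1 + 1)‖ ^ j i := by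
        rw [prod_repArgs j _ norm]
    _ ≤ (M * a ^ (∑ i, j i) * (∑ i, j i).factorial) *
          ∏ i : Fin n, (catalan i * M ^ (i.1 + 1) * a ^ i.1) ^ j i := by
        gcongr with i
        · exact hderiv _
        · exact hu i i.2
    _ = (M * a ^ (∑ i, j i) * (∑ i, j i).factorial) *
          ((∏ i : Fin n, (catalan i : ℝ) ^ j i) * M ^ n * a ^ (∑ i : Fin n, i.1 * j i)) := by
        simp only [mul_pow, Finset.prod_mul_distrib, ← pow_mul, Finset.prod_pow_eq_pow_sum, hj']
    _ = _ := by
        rw [← hmul, show a ^ n = a ^ (∑ i, j i) * a ^ (∑ i : Fin n, i.1 * j i) by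
          rw [← pow_add, hsum]]
        push_cast
        ring

/-- If `N` is analytic at `f` with infinite radius of convergence and
`‖N^{(n)}(f)‖ ≤ M a^n n!` for all `n`, with `M, a > 0`, then the terms of the Adomian
sequence satisfy `‖u_n‖ ≤ ((2n-1)!/(n!)²) M^n a^{n-1}` for every `n ≥ 1`. -/
theorem adomian_term_bound
    (N : X → X) (f : X) (M a : ℝ) (hM : 0 < M) (ha : 0 < a)
    (hN : HasEntireExpansionAt N f)
    (hderiv : ∀ n : ℕ, ‖iteratedFDeriv ℝ n N f‖ ≤ M * a ^ n * n.factorial)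
    (u : ℕ → X) (hu0 : u 0 = f) (hu : ∀ n : ℕ, u (n + 1) = adomianA N f u n) :
    ∀ n : ℕ, 1 ≤ n →
      ‖u n‖ ≤ ((2 * n - 1).factorial : ℝ) / ((n.factorial : ℝ)) ^ 2 * M ^ n * a ^ (n - 1) := by
  have key : ∀ n : ℕ, ‖u (n + 1)‖ ≤ catalan n * M ^ (n + 1) * a ^ n := by
    intro n
    induction n using Nat.strong_induction_on with
    | _ n ih =>
      rw [hu]
      exact norm_adomianA_le hM.le ha.le hderiv ih
  intro n hn
  obtain ⟨n, rfl⟩ := Nat.exists_eq_add_of_le' hn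
  refine (key n).trans ?_
  rw [Nat.add_sub_cancel]
  gcongr
  exact catalan_le_factorial_div n
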